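/- Let k ≥ 2 be an integer and let c < (k−1)·log(k−1) be a positive constant. Then liminf over n of the probability that the random multigraph G(kn, m=⌊ckn⌋) admits a proper k-coloring is strictly positive. -/

import Mathlib

open Finset Filter
open scoped Classical

/-- A proper `k`-coloring of the multigraph on `Fin n` whose `m` edges are given by
`e : Fin m → Fin n × Fin n`: an assignment of colors under which no edge
(in particular, no loop) is monochromatic. -/
def IsProperColoring {n m k : ℕ} (e : Fin m → Fin n × Fin n) (σ : Fin n → Fin k) : Prop :=
  ∀ i : Fin m, σ (e i).1 ≠ σ (e i).2

/-- The probability that the random multigraph `G(n,m)` (with `m` edges, each formed by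
joining two vertices chosen uniformly, independently and with replacement) satisfies the
property `P` of its edge configuration. -/
noncomputable def multigraphProb (n m : ℕ) (P : (Fin m → Fin n × Fin n) → Prop) : ℝ :=
  (Finset.univ.filter P).card / ((n : ℝ) ^ 2) ^ m

lemma log_le_div_exp {x : ℝ} (hx : 0 < x) : Real.log x ≤ 5 / 13 * x := by
  have h := Real.log_le_sub_one_of_pos (x := x / Real.exp 1) (by positivity)
  rw [Real.log_div hx.ne' (by positivity), Real.log_exp] at h
  have h2 : x / Real.exp 1 ≤ 5 / 13 * x := by
    rw [div_le_iff₀ (by positivity)]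
    nlinarith [Real.exp_one_gt_d9]
  linarith

lemma half_sq_le_mul_log {r : ℝ} (h0 : 0 ≤ r) (h1 : r ≤ 1) :
    (r - 1) ^ 2 / 2 ≤ r * Real.log r - r + 1 := by
  rcases h0.eq_or_lt with rfl | h0
  · norm_num
  have h := Real.self_le_sinh_iff.2 (Real.log_nonneg ((one_le_inv₀ h0).2 h1))
  rw [Real.sinh_log (by positivity), Real.log_inv, inv_inv] at h
  have h3 : r * -Real.log r ≤ r * ((r⁻¹ - r) / 2) := by gcongr
  have h4 : r * ((r⁻¹ - r) / 2) = (1 - r ^ 2) / 2 := by field_simp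
  nlinarith

lemma pade_le_log {r : ℝ} (hr : 1 ≤ r) :
    3 * (r ^ 2 - 1) / (r ^ 2 + 4 * r + 1) ≤ Real.log r := by
  have hd : ∀ x ∈ Set.Ici (1 : ℝ), HasDerivAt
      (fun x : ℝ => Real.log x - 3 * (x ^ 2 - 1) / (x ^ 2 + 4 * x + 1))
      ((x - 1) ^ 4 / (x * (x ^ 2 + 4 * x + 1) ^ 2)) x := by
    intro x hx
    have hx : 1 ≤ x := hx
    have hx0 : 0 < x := by linarith
    have hne : x ^ 2 + 4 * x + 1 ≠ 0 := by positivity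
    have h1 : HasDerivAt (fun x : ℝ => 3 * (x ^ 2 - 1)) (3 * (2 * x)) x := by
      simpa using (((hasDerivAt_id x).pow 2).sub_const 1).const_mul 3
    have h2 : HasDerivAt (fun x : ℝ => x ^ 2 + 4 * x + 1) (2 * x + 4) x := by
      simpa using ((((hasDerivAt_id x).pow 2).add ((hasDerivAt_id x).const_mul 4)).add_const 1)
    refine ((Real.hasDerivAt_log hx0.ne').sub (h1.div h2 hne)).congr_deriv ?_
    field_simp
    ring
  have hm : MonotoneOn (fun x : ℝ => Real.log x - 3 * (x ^ 2 - 1) / (x ^ 2 + 4 * x + 1))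
      (Set.Ici 1) := by
    refine monotoneOn_of_deriv_nonneg (convex_Ici 1)
      (fun x hx => (hd x hx).continuousAt.continuousWithinAt)
      (fun x hx => (hd x (interior_subset hx)).differentiableAt.differentiableWithinAt) ?_
    intro x hx
    have hx' := interior_subset hx
    rw [(hd x hx').deriv]
    have : (1 : ℝ) ≤ x := hx'
    positivity
  have := hm (Set.mem_Ici.2 le_rfl) (Set.mem_Ici.2 hr) hr
  simp at this
  linarith

lemma log_mul_sq_le {n r : ℝ} (hn : 2 ≤ n) (hr : 1 ≤ r) (hrn : r ≤ n) :
    (n + 1) * Real.log n * (r - 1) ^ 2 ≤ n * (n + r) * (r * Real.log r - r + 1) := by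
  have hp := pade_le_log hr
  have hden : 0 < r ^ 2 + 4 * r + 1 := by positivity
  rw [div_le_iff₀ hden] at hp
  rcases le_total r 2 with h2 | h2
  · have hl := log_le_div_exp (x := n) (by linarith)
    have hG : 5 / 13 * (r - 1) ^ 2 ≤ r * Real.log r - r + 1 := by
      have : 0 ≤ (r * Real.log r - r + 1 - 5 / 13 * (r - 1) ^ 2) * (r ^ 2 + 4 * r + 1) := by
        have e : 0 ≤ (r - 1) ^ 2 * ((2 - r) * (5 * r + 4)) := by
          have : 0 ≤ 2 - r := by linarith
          positivity
        nlinarith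
      nlinarith [nonneg_of_mul_nonneg_left this hden]
    calc (n + 1) * Real.log n * (r - 1) ^ 2 ≤ (n + 1) * (5 / 13 * n) * (r - 1) ^ 2 := by gcongr
      _ = n * (n + 1) * (5 / 13 * (r - 1) ^ 2) := by ring
      _ ≤ n * (n + r) * (r * Real.log r - r + 1) := by
        have : 0 ≤ r * Real.log r - r + 1 := le_trans (by positivity) hG
        gcongr
  · obtain ⟨b, hb⟩ : ∃ b, n = b * r := ⟨n / r, by field_simp⟩
    have hr0 : 0 < r := by linarith
    have hb1 : 1 ≤ b := by
      by_contra! h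
      nlinarith
    have hlb : Real.log b ≤ (b + 1) / 2 - 4 / 5 := by
      have := Real.log_le_sub_one_of_pos (x := b / 2) (by positivity)
      rw [Real.log_div (by positivity) (by norm_num)] at this
      linarith [Real.log_two_lt_d9]
    have hln : Real.log n = Real.log b + Real.log r := by
      rw [hb, Real.log_mul (by positivity) (by positivity)]
    set l := Real.log r
    -- `2κ ≥ l + 1/5` with `κ = r²(rl - r + 1) / ((r-1)²(r+1))`
    have hk : (l + 1 / 5) * ((r - 1) ^ 2 * (r + 1)) ≤ 2 * (r ^ 2 * (r * l - r + 1)) := by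
      have e1 : (r - 1) * (11 / 5 * r ^ 2 - 1 / 5) ≤ l * (r ^ 3 + r ^ 2 + r - 1) := by
        have h3 : 0 < r ^ 3 + r ^ 2 + r - 1 := by nlinarith [pow_pos hr0 3]
        have h4 : (r - 1) * (11 / 5 * r ^ 2 - 1 / 5) * (r ^ 2 + 4 * r + 1)
            ≤ 3 * (r ^ 2 - 1) * (r ^ 3 + r ^ 2 + r - 1) := by
          obtain ⟨s, hs, rfl⟩ : ∃ s, 0 ≤ s ∧ r = s + 2 := ⟨r - 2, by linarith, by ring⟩
          rw [← sub_nonneg]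
          have : 3 * ((s + 2) ^ 2 - 1) * ((s + 2) ^ 3 + (s + 2) ^ 2 + (s + 2) - 1) -
            (s + 2 - 1) * (11 / 5 * (s + 2) ^ 2 - 1 / 5) * ((s + 2) ^ 2 + 4 * (s + 2) + 1)
            = (s + 1) * (4 / 5 * s ^ 4 + 18 / 5 * s ^ 3 + 32 / 5 * s ^ 2 + 44 / 5 * s + 26 / 5) := by
              ring
          rw [this]; positivity
        have h5 := mul_le_mul_of_nonneg_right hp h3.le
        refine le_of_mul_le_mul_right (h4.trans (h5.trans_eq ?_)) hden
        ring
      nlinarith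
    have hl0 : 0 ≤ l := Real.log_nonneg hr
    have hB : 0 ≤ (r - 1) ^ 2 * (r + 1) := by positivity
    have hA : (r - 1) ^ 2 * (r + 1) ≤ 2 * (r ^ 2 * (r * l - r + 1)) := by
      have h4 : 0 ≤ (r * l - r + 1) * (r ^ 2 + 4 * r + 1) - (2 * r + 1) * (r - 1) ^ 2 := by
        nlinarith
      have h5 : (r + 1) * (r ^ 2 + 4 * r + 1) ≤ 2 * r ^ 2 * (2 * r + 1) := by
        obtain ⟨s, hs, rfl⟩ : ∃ s, 0 ≤ s ∧ r = s + 2 := ⟨r - 2, by linarith, by ring⟩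
        rw [← sub_nonneg]
        have : 2 * (s + 2) ^ 2 * (2 * (s + 2) + 1)
            - (s + 2 + 1) * ((s + 2) ^ 2 + 4 * (s + 2) + 1)
            = 3 * s ^ 3 + 15 * s ^ 2 + 19 * s + 1 := by ring
        rw [this]; positivity
      have h6 := mul_le_mul_of_nonneg_left h5 (sq_nonneg (r - 1))
      have h7 := mul_nonneg (by positivity : 0 ≤ 2 * r ^ 2) h4
      refine le_of_mul_le_mul_right ?_ hden
      linarith
    set W := (r - 1) ^ 2 * (r + 1)
    set V := r ^ 2 * (r * l - r + 1) with hV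
    have key : W * (l + Real.log b) ≤ (b + 1) * V := by
      have h1 : W * (l + Real.log b) ≤ W * (l + ((b + 1) / 2 - 4 / 5)) := by gcongr
      nlinarith
    have hsum : 0 ≤ l + Real.log b := add_nonneg hl0 (Real.log_nonneg hb1)
    rw [hln, hb]
    calc (b * r + 1) * (Real.log b + l) * (r - 1) ^ 2
        ≤ (b * (r + 1)) * (Real.log b + l) * (r - 1) ^ 2 := by
          gcongr ?_ * _ * _
          · linarith
          · linarith
      _ = b * (W * (l + Real.log b)) := by ring
      _ ≤ b * ((b + 1) * V) := by gcongr
      _ = b * r * (b * r + r) * (r * l - r + 1) := by rw [hV]; ring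

lemma log_sub_log_mul_le {s t : ℝ} (hs : 0 ≤ s) (hst : s ≤ t) (ht : t < 1) :
    t * (Real.log (1 + s) - Real.log (1 - s)) ≤ s * (Real.log (1 + t) - Real.log (1 - t)) := by
  have h1 := (Real.hasSum_log_sub_log_of_abs_lt_one (x := s)
    (by rw [abs_of_nonneg hs]; linarith)).mul_left t
  have h2 := (Real.hasSum_log_sub_log_of_abs_lt_one (x := t)
    (by rw [abs_of_nonneg (hs.trans hst)]; linarith)).mul_left s
  refine hasSum_le (fun j => ?_) h1 h2
  have h3 : s ^ (2 * j) ≤ t ^ (2 * j) := by gcongr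
  have h4 : 0 ≤ s * t * (2 * (1 / (2 * (j : ℝ) + 1))) := by
    have := hs.trans hst
    positivity
  calc t * (2 * (1 / (2 * (j : ℝ) + 1)) * s ^ (2 * j + 1))
      = s * t * (2 * (1 / (2 * (j : ℝ) + 1))) * s ^ (2 * j) := by ring
    _ ≤ s * t * (2 * (1 / (2 * (j : ℝ) + 1))) * t ^ (2 * j) := by gcongr
    _ = _ := by ring

lemma symm_entropy_ge {s t : ℝ} (hs : 0 ≤ s) (hs1 : s < 1) (ht : 0 < t) (ht1 : t < 1) :
    (Real.log (1 + t) - Real.log (1 - t)) / (2 * t) * (s ^ 2 - t ^ 2) ≤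
      ((1 + s) * Real.log (1 + s) + (1 - s) * Real.log (1 - s)) -
      ((1 + t) * Real.log (1 + t) + (1 - t) * Real.log (1 - t)) := by
  set b := (Real.log (1 + t) - Real.log (1 - t)) / (2 * t) with hb
  have hbt : 2 * b * t = Real.log (1 + t) - Real.log (1 - t) := by rw [hb]; field_simp
  let F : ℝ → ℝ := fun u =>
    (1 + u) * Real.log (1 + u) + (1 - u) * Real.log (1 - u) - b * u ^ 2
  have hd : ∀ u : ℝ, 0 ≤ u → u < 1 → HasDerivAt F
      (Real.log (1 + u) - Real.log (1 - u) - 2 * b * u) u := by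
    intro u h0 h1
    have e1 : HasDerivAt (fun u : ℝ => 1 + u) 1 u := by
      simpa using (hasDerivAt_id u).const_add 1
    have e2 : HasDerivAt (fun u : ℝ => 1 - u) (-1) u := by
      simpa using (hasDerivAt_id u).const_sub 1
    have n1 : 1 + u ≠ 0 := by positivity
    have n2 : 1 - u ≠ 0 := by linarith
    have e3 : HasDerivAt (fun u : ℝ => b * u ^ 2) (b * (2 * u)) u := by
      simpa using ((hasDerivAt_id u).pow 2).const_mul b
    refine (((e1.mul (e1.log n1)).add (e2.mul (e2.log n2))).sub e3).congr_deriv ?_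
    field_simp
    ring
  suffices h : F t ≤ F s by simp only [F] at h; linarith
  rcases le_total s t with hst | hst
  · refine antitoneOn_of_deriv_nonpos (convex_Icc 0 t)
      (fun u hu => (hd u hu.1 (hu.2.trans_lt ht1)).continuousAt.continuousWithinAt)
      (fun u hu => ?_) (fun u hu => ?_) ⟨hs, hst⟩ ⟨ht.le, le_rfl⟩ hst
    · have hu := interior_subset hu
      exact (hd u hu.1 (hu.2.trans_lt ht1)).differentiableAt.differentiableWithinAt
    · have hu := interior_subset hu
      rw [(hd u hu.1 (hu.2.trans_lt ht1)).deriv]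
      have := log_sub_log_mul_le hu.1 hu.2 ht1
      rw [← hbt] at this
      nlinarith
  · refine monotoneOn_of_deriv_nonneg (convex_Icc t s)
      (fun u hu => (hd u (ht.le.trans hu.1) (hu.2.trans_lt hs1)).continuousAt.continuousWithinAt)
      (fun u hu => ?_) (fun u hu => ?_) ⟨le_rfl, hst⟩ ⟨hst, le_rfl⟩ hst
    · have hu := interior_subset hu
      exact (hd u (ht.le.trans hu.1) (hu.2.trans_lt hs1)).differentiableAt.differentiableWithinAt
    · have hu := interior_subset hu
      rw [(hd u (ht.le.trans hu.1) (hu.2.trans_lt hs1)).deriv]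
      have := log_sub_log_mul_le ht.le hu.1 (hu.2.trans_lt hs1)
      rw [← hbt] at this
      nlinarith

lemma symm_entropy_ge' {s t : ℝ} (hs : |s| < 1) (ht : 0 < t) (ht1 : t < 1) :
    (Real.log (1 + t) - Real.log (1 - t)) / (2 * t) * (s ^ 2 - t ^ 2) ≤
      ((1 + s) * Real.log (1 + s) + (1 - s) * Real.log (1 - s)) -
      ((1 + t) * Real.log (1 + t) + (1 - t) * Real.log (1 - t)) := by
  rcases abs_cases s with ⟨h, h0⟩ | ⟨h, h0⟩
  · exact symm_entropy_ge h0 (h ▸ hs) ht ht1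
  · have := symm_entropy_ge (s := -s) (by linarith) (h ▸ hs) ht ht1
    rw [neg_sq, sub_neg_eq_add, ← sub_eq_add_neg] at this
    linarith

lemma two_value_entropy_ge {n x : ℝ} (hn : 2 ≤ n) (hx : 0 < x) (hx1 : x < 1) :
    (n + 1) * Real.log n / n * (x ^ 2 + (1 - x) ^ 2 / n - 1 / (n + 1)) ≤
      x * Real.log x + (1 - x) * Real.log ((1 - x) / n) + Real.log (n + 1) := by
  have hn0 : 0 < n := by linarith
  have hn1 : 0 < n - 1 := by linarith
  have h := symm_entropy_ge' (s := 2 * x - 1) (t := (n - 1) / (n + 1))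
    (abs_lt.2 ⟨by linarith, by linarith⟩) (by positivity)
    ((div_lt_one (by positivity)).2 (by linarith))
  have a1 : 1 + (n - 1) / (n + 1) = 2 * n / (n + 1) := by field_simp; ring
  have a2 : 1 - (n - 1) / (n + 1) = 2 / (n + 1) := by field_simp; ring
  have a3 : 1 + (2 * x - 1) = 2 * x := by ring
  have a4 : 1 - (2 * x - 1) = 2 * (1 - x) := by ring
  have hx2 : 0 < 1 - x := by linarith
  rw [a1, a2, a3, a4, Real.log_mul (by norm_num) hx.ne', Real.log_mul (by norm_num) hx2.ne',
    Real.log_div (by positivity) (by positivity), Real.log_div (by positivity) (by positivity),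
    Real.log_mul (by norm_num) hn0.ne'] at h
  rw [Real.log_div hx2.ne' hn0.ne']
  set L := Real.log n with hL
  have hL0 : 0 ≤ L := Real.log_nonneg (by linarith)
  have e1 : (Real.log 2 + L - Real.log (n + 1) - (Real.log 2 - Real.log (n + 1))) /
      (2 * ((n - 1) / (n + 1))) * ((2 * x - 1) ^ 2 - ((n - 1) / (n + 1)) ^ 2)
      = 2 * L * (((n + 1) * x - 1) ^ 2 / (n ^ 2 - 1) - (x - 1 / (n + 1))) := by
    have : n ^ 2 - 1 = (n - 1) * (n + 1) := by ring
    rw [this]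
    field_simp
    ring
  have e2 : 2 * n / (n + 1) * (Real.log 2 + L - Real.log (n + 1)) +
      2 / (n + 1) * (Real.log 2 - Real.log (n + 1))
      = 2 * Real.log 2 - 2 * Real.log (n + 1) + 2 * n / (n + 1) * L := by
    field_simp
    ring
  rw [e1, e2] at h
  have e3 : (n + 1) * L / n * (x ^ 2 + (1 - x) ^ 2 / n - 1 / (n + 1))
      = L * (((n + 1) * x - 1) ^ 2 / n ^ 2) := by
    field_simp
    ring
  have e4 : ((n + 1) * x - 1) ^ 2 / n ^ 2 ≤ ((n + 1) * x - 1) ^ 2 / (n ^ 2 - 1) := by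
    have : 0 < n ^ 2 - 1 := by nlinarith
    gcongr
    linarith
  have e5 := mul_le_mul_of_nonneg_left e4 hL0
  have e6 : 2 * n / (n + 1) * L = 2 * L - 2 * L * (1 / (n + 1)) := by field_simp; ring
  rw [e3]
  rw [e6] at h
  linarith

lemma tangent_le {n x y t : ℝ} (hn : 2 ≤ n) (hy : 0 < y) (hyx : y ≤ x) (hxy : x + n * y = 1)
    (ht : 0 ≤ t) (htx : t ≤ x) (htn : t ≤ n * y) :
    (n + 1) * Real.log n / n * (t - y) ^ 2 ≤ t * Real.log t - t * Real.log y - t + y := by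
  have hn0 : 0 < n := by linarith
  obtain ⟨r, rfl⟩ : ∃ r, t = r * y := ⟨t / y, by field_simp⟩
  have hr0 : 0 ≤ r := nonneg_of_mul_nonneg_left ht hy
  have hrn : r ≤ n := le_of_mul_le_mul_right htn hy
  have hL0 : 0 ≤ Real.log n := Real.log_nonneg (by linarith)
  have key : (n + 1) * Real.log n / n * y * (r - 1) ^ 2 ≤ r * Real.log r - r + 1 := by
    rcases le_total r 1 with h1 | h1
    · refine le_trans ?_ (half_sq_le_mul_log hr0 h1)
      have : (n + 1) * y ≤ 1 := by nlinarith
      have h2 : Real.log n / n ≤ 1 / 2 := by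
        rw [div_le_iff₀ hn0]
        linarith [log_le_div_exp hn0]
      have h3 : (n + 1) * Real.log n / n * y ≤ 1 / 2 := by
        calc (n + 1) * Real.log n / n * y = (n + 1) * y * (Real.log n / n) := by ring
          _ ≤ 1 * (1 / 2) := by gcongr
          _ = _ := by norm_num
      nlinarith [sq_nonneg (r - 1)]
    · have h2 := log_mul_sq_le hn h1 hrn
      have h3 : (n + r) * y ≤ 1 := by nlinarith
      have h4 : (n + 1) * Real.log n / n * (r - 1) ^ 2 ≤ (n + r) * (r * Real.log r - r + 1) := by
        rw [div_mul_eq_mul_div, div_le_iff₀ hn0]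
        linarith
      have h5 : 0 ≤ r * Real.log r - r + 1 := by
        have : 0 ≤ (n + r) * (r * Real.log r - r + 1) := le_trans (by positivity) h4
        exact nonneg_of_mul_nonneg_right this (by positivity)
      calc (n + 1) * Real.log n / n * y * (r - 1) ^ 2
          = (n + 1) * Real.log n / n * (r - 1) ^ 2 * y := by ring
        _ ≤ (n + r) * (r * Real.log r - r + 1) * y := by gcongr
        _ = (n + r) * y * (r * Real.log r - r + 1) := by ring
        _ ≤ 1 * (r * Real.log r - r + 1) := by gcongr
        _ = _ := one_mul _
  have hlog : r * y * Real.log (r * y) - r * y * Real.log y = y * (r * Real.log r) := by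
    rcases hr0.eq_or_lt with rfl | h
    · simp
    · rw [Real.log_mul h.ne' hy.ne']; ring
  calc (n + 1) * Real.log n / n * (r * y - y) ^ 2
      = y * ((n + 1) * Real.log n / n * y * (r - 1) ^ 2) := by ring
    _ ≤ y * (r * Real.log r - r + 1) := by gcongr
    _ = _ := by rw [hlog]; ring

lemma entropy_deficit_ge {k : ℕ} (hk : 3 ≤ k) (p : Fin k → ℝ) (hp : ∀ i, 0 ≤ p i)
    (hsum : ∑ i, p i = 1) :
    (k : ℝ) * Real.log (k - 1) / (k - 1) * (∑ i, p i ^ 2 - 1 / k) ≤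
      ∑ i, p i * Real.log (p i) + Real.log k := by
  obtain ⟨n, hn⟩ : ∃ n : ℝ, (k : ℝ) = n + 1 := ⟨k - 1, by ring⟩
  have hn2 : 2 ≤ n := by
    have : (3 : ℝ) ≤ k := by exact_mod_cast hk
    linarith
  have hn0 : 0 < n := by linarith
  have : Nonempty (Fin k) := ⟨⟨0, by omega⟩⟩
  obtain ⟨a, ha⟩ := Finite.exists_max p
  rw [hn, add_sub_cancel_right]
  set K := (n + 1) * Real.log n / n with hK
  have hs1 : p a + ∑ i ∈ univ.erase a, p i = 1 := by
    rw [add_sum_erase _ _ (mem_univ a), hsum]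
  have hcard : ((univ.erase a).card : ℝ) = n := by
    rw [card_erase_of_mem (mem_univ a), card_univ, Fintype.card_fin, Nat.cast_sub (by omega), hn]
    simp
  have hax : 1 ≤ (n + 1) * p a := by
    calc (1 : ℝ) = ∑ i, p i := hsum.symm
      _ ≤ ∑ _i : Fin k, p a := sum_le_sum fun i _ => ha i
      _ = (n + 1) * p a := by simp [hn]
  have hx0 : 0 < p a := by
    by_contra! h
    nlinarith
  have hle : ∀ i ∈ univ.erase a, p i ≤ 1 - p a := by
    intro i hi
    have := single_le_sum (f := p) (fun j _ => hp j) hi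
    linarith
  rw [← add_sum_erase _ _ (mem_univ a), ← add_sum_erase _ (fun i => p i * _) (mem_univ a)]
  rcases (by linarith [sum_nonneg (s := univ.erase a) fun i _ => hp i] :
    p a ≤ 1).eq_or_lt with h1 | h1
  · have hz : ∀ i ∈ univ.erase a, p i = 0 := fun i hi =>
      le_antisymm (by linarith [hle i hi]) (hp i)
    rw [sum_eq_zero (fun i hi => by rw [hz i hi]; ring),
      sum_eq_zero (fun i hi => by rw [hz i hi]; ring), h1]
    have : K * (1 ^ 2 + 0 - 1 / (n + 1)) = Real.log n := by
      rw [hK]; field_simp; ring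
    rw [this]
    simpa using Real.log_le_log hn0 (by linarith)
  · set y := (1 - p a) / n with hy
    have hny : n * y = 1 - p a := by rw [hy]; field_simp
    have hy0 : 0 < y := by rw [hy]; exact div_pos (by linarith) hn0
    have hyx : y ≤ p a := by rw [hy, div_le_iff₀ hn0]; linarith
    have htan : ∑ i ∈ univ.erase a, K * (p i - y) ^ 2 ≤
        ∑ i ∈ univ.erase a, (p i * Real.log (p i) - p i * Real.log y - p i + y) :=
      sum_le_sum fun i hi => tangent_le hn2 hy0 hyx (by linarith) (hp i) (ha i)
        (by linarith [hle i hi])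
    have e1 : ∑ i ∈ univ.erase a, (p i - y) ^ 2 = ∑ i ∈ univ.erase a, p i ^ 2 - n * y ^ 2 := by
      have : ∀ i, (p i - y) ^ 2 = p i ^ 2 - 2 * y * p i + y ^ 2 := fun i => by ring
      simp_rw [this]
      rw [sum_add_distrib, sum_sub_distrib, ← mul_sum, sum_const, nsmul_eq_mul, hcard,
        show ∑ i ∈ univ.erase a, p i = n * y by linarith]
      ring
    rw [← mul_sum, e1, sum_add_distrib, sum_sub_distrib, sum_sub_distrib, ← sum_mul, sum_const,
      nsmul_eq_mul, hcard, show ∑ i ∈ univ.erase a, p i = n * y by linarith] at htan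
    have h2 := two_value_entropy_ge hn2 hx0 h1
    rw [← hK, ← hy, ← hny] at h2
    have e2 : (n * y) ^ 2 / n = n * y ^ 2 := by field_simp
    rw [e2] at h2
    linarith

lemma log_factorial_le {n : ℕ} (hn : 1 ≤ n) :
    Real.log n.factorial ≤ 1 + Real.log n / 2 + n * Real.log n - n := by
  obtain ⟨m, rfl⟩ : ∃ m, n = m + 1 := ⟨n - 1, by omega⟩
  have h := Stirling.log_stirlingSeq'_antitone (Nat.zero_le m)
  simp only [Function.comp, Nat.succ_eq_add_one, zero_add] at h
  rw [Stirling.log_stirlingSeq_formula, Stirling.log_stirlingSeq_formula] at h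
  have hm : (0 : ℝ) < ((m + 1 : ℕ) : ℝ) := by positivity
  rw [Real.log_mul (by norm_num) hm.ne', Real.log_div hm.ne' (by positivity), Real.log_exp] at h
  simp at h
  push_cast at h ⊢
  linarith

lemma le_log_factorial (n : ℕ) :
    Real.log (max 1 n) / 2 + n * Real.log n - n ≤ Real.log n.factorial := by
  rcases Nat.eq_zero_or_pos n with rfl | hn
  · simp
  · have h := Stirling.le_log_factorial_stirling hn.ne'
    have h1 : (1 : ℝ) ≤ n := by exact_mod_cast hn
    rw [max_eq_right h1]
    have h2 : 0 ≤ Real.log (2 * Real.pi) :=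
      Real.log_nonneg (by linarith [Real.pi_gt_three])
    linarith

lemma sum_exp_neg_le {b : ℝ} (hb : 0 < b) (N : ℕ) :
    ∑ z ∈ range N, Real.exp (-b * z) ≤ 1 + 1 / b := by
  have hlt : Real.exp (-b) < 1 := by rw [Real.exp_lt_one_iff]; linarith
  have hg : ∑ z ∈ range N, Real.exp (-b * z) ≤ (1 - Real.exp (-b))⁻¹ := by
    have := (summable_geometric_of_lt_one (Real.exp_pos _).le hlt).sum_le_tsum (range N)
      fun i _ => by positivity
    rw [tsum_geometric_of_lt_one (Real.exp_pos _).le hlt] at this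
    refine le_trans (le_of_eq (sum_congr rfl fun z _ => ?_)) this
    rw [← Real.exp_nat_mul]
    ring_nf
  refine hg.trans ?_
  rw [inv_le_iff_one_le_mul₀ (by linarith)]
  have h1 : Real.exp (-b) ≤ 1 / (1 + b) := by
    rw [Real.exp_neg, ← one_div]
    gcongr
    linarith [Real.add_one_le_exp b]
  calc (1 : ℝ) = (1 - 1 / (1 + b)) * (1 + 1 / b) := by field_simp; ring
    _ ≤ (1 - Real.exp (-b)) * (1 + 1 / b) := by gcongr
    _ = _ := by ring

lemma sum_exp_neg_abs_le {b μ : ℝ} (hb : 0 < b) (hμ : 0 ≤ μ) (N : ℕ) :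
    ∑ z ∈ range N, Real.exp (-b * |z - μ|) ≤ (1 + Real.exp b) * (1 + 1 / b) := by
  set q := ⌊μ⌋₊
  have hq : (q : ℝ) ≤ μ := Nat.floor_le hμ
  have hq1 : μ < q + 1 := Nat.lt_floor_add_one μ
  have h1 : ∑ z ∈ range q, Real.exp (-b * |z - μ|) ≤ 1 + 1 / b := by
    rw [← sum_range_reflect]
    refine (sum_le_sum fun z hz => ?_).trans (sum_exp_neg_le hb q)
    have hz : z + 1 ≤ q := by simpa using hz
    rw [Real.exp_le_exp, Nat.sub_sub, Nat.cast_sub (by omega)]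
    push_cast
    have := neg_abs_le ((q : ℝ) - (1 + z) - μ)
    nlinarith
  have h2 : ∑ x ∈ range N, Real.exp (-b * |(q + x : ℕ) - μ|) ≤ Real.exp b * (1 + 1 / b) := by
    refine (sum_le_sum fun z hz => ?_).trans
      ((mul_sum _ _ _).symm.trans_le (mul_le_mul_of_nonneg_left (sum_exp_neg_le hb N)
        (Real.exp_pos b).le))
    rw [← Real.exp_add, Real.exp_le_exp]
    push_cast
    have := le_abs_self ((q : ℝ) + z - μ)
    nlinarith
  calc ∑ z ∈ range N, Real.exp (-b * |z - μ|)
      ≤ ∑ z ∈ range (q + N), Real.exp (-b * |z - μ|) :=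
        sum_le_sum_of_subset_of_nonneg (range_mono (by omega)) fun _ _ _ => (Real.exp_pos _).le
    _ ≤ (1 + 1 / b) + Real.exp b * (1 + 1 / b) := by
        rw [sum_range_add]; exact add_le_add h1 h2
    _ = _ := by ring

lemma sum_gaussian_le {δ μ : ℝ} (hδ : 0 < δ) (hμ : 0 ≤ μ) {n : ℕ} (hn : 1 ≤ n) (N : ℕ) :
    ∑ z ∈ range N, Real.exp (-δ * ((z - μ) ^ 2 / n)) ≤
      Real.exp δ * (1 + Real.exp (2 * δ)) * (1 + 1 / (2 * δ)) * √n := by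
  have hs1 : 1 ≤ √(n : ℝ) := Real.one_le_sqrt.2 (by exact_mod_cast hn)
  have hsq : √(n : ℝ) ^ 2 = n := Real.sq_sqrt (Nat.cast_nonneg n)
  set s := √(n : ℝ)
  have hs : 0 < s := by linarith
  have hterm : ∀ z : ℕ, Real.exp (-δ * ((z - μ) ^ 2 / n)) ≤
      Real.exp δ * Real.exp (-(2 * δ / s) * |z - μ|) := by
    intro z
    rw [← Real.exp_add, Real.exp_le_exp, ← hsq, ← sub_nonneg]
    have : δ + -(2 * δ / s) * |z - μ| - -δ * ((z - μ) ^ 2 / s ^ 2)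
        = δ * (|z - μ| / s - 1) ^ 2 := by
      rw [← sq_abs ((z : ℝ) - μ)]
      field_simp
      ring
    rw [this]
    positivity
  have hb : 2 * δ / s ≤ 2 * δ := div_le_self (by positivity) hs1
  calc _ ≤ ∑ z ∈ range N, Real.exp δ * Real.exp (-(2 * δ / s) * |z - μ|) :=
        sum_le_sum fun z _ => hterm z
    _ = Real.exp δ * ∑ z ∈ range N, Real.exp (-(2 * δ / s) * |z - μ|) := by rw [mul_sum]
    _ ≤ Real.exp δ * ((1 + Real.exp (2 * δ / s)) * (1 + 1 / (2 * δ / s))) := by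
        gcongr
        exact sum_exp_neg_abs_le (by positivity) hμ N
    _ ≤ Real.exp δ * ((1 + Real.exp (2 * δ)) * ((1 + 1 / (2 * δ)) * s)) := by
        gcongr
        rw [one_div_div, add_mul, one_mul, one_div_mul_eq_div]
        gcongr
    _ = _ := by ring

/-- Entries of an overlap matrix contribute a factor `n ^ (-1/2)`, up to a Gaussian correction. -/
lemma exists_log_max_bound {k : ℕ} (hk : 1 ≤ k) {ε : ℝ} (hε : 0 < ε) :
    ∃ C : ℝ, ∀ n M : ℕ, 1 ≤ n →
      Real.log n / 2 ≤ Real.log (max 1 M) / 2 + C + ε * ((M - n / k : ℝ) ^ 2 / n) := by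
  have hk0 : (0 : ℝ) < k := by exact_mod_cast hk
  refine ⟨|Real.log (2 * k)| / 2 + |Real.log (2 * k ^ 2 / ε)| / 2, fun n M hn => ?_⟩
  have hn0 : (0 : ℝ) < n := by exact_mod_cast hn
  have hmax : 0 ≤ Real.log (max 1 (M : ℝ)) := Real.log_nonneg (le_max_left _ _)
  rcases le_or_gt ((n : ℝ) / (2 * k)) M with h | h
  · have h1 : Real.log (n / (2 * k)) ≤ Real.log (max 1 (M : ℝ)) :=
      Real.log_le_log (by positivity) (h.trans (le_max_right _ _))
    rw [Real.log_div hn0.ne' (by positivity)] at h1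
    have h2 := le_abs_self (Real.log (2 * k))
    have h3 : 0 ≤ |Real.log (2 * k ^ 2 / ε)| := abs_nonneg _
    have h4 : 0 ≤ ε * ((M - n / k : ℝ) ^ 2 / n) := by positivity
    linarith
  · have h1 := Real.log_le_sub_one_of_pos (x := n / (2 * k ^ 2 / ε)) (by positivity)
    rw [Real.log_div hn0.ne' (by positivity)] at h1
    have h2 := le_abs_self (Real.log (2 * k ^ 2 / ε))
    have h3 : 0 ≤ |Real.log (2 * k)| := abs_nonneg _
    have h4 : n / (4 * k ^ 2) ≤ (M - n / k : ℝ) ^ 2 / n := by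
      rw [le_div_iff₀ hn0]
      have h5 : (n : ℝ) / (2 * k) ≤ n / k - M := by
        have : (n : ℝ) / k = n / (2 * k) + n / (2 * k) := by field_simp; ring
        linarith
      calc (n : ℝ) / (4 * (k : ℝ) ^ 2) * (n : ℝ) = ((n : ℝ) / (2 * k)) ^ 2 := by field_simp; ring
        _ ≤ ((n : ℝ) / k - M) ^ 2 := by gcongr
        _ = _ := by ring
    have h6 : ε * (n / (4 * k ^ 2)) = n / (2 * k ^ 2 / ε) / 2 := by field_simp; ring
    have h7 := mul_le_mul_of_nonneg_left h4 hε.le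
    linarith

lemma row_entropy_ge {k n : ℕ} (hk : 3 ≤ k) (hn : 1 ≤ n) (M : Fin k → ℕ) (hM : ∑ j, M j = n) :
    (k : ℝ) * Real.log (k - 1) / (k - 1) * ∑ j, ((M j : ℝ) - n / k) ^ 2 / n ≤
      ∑ j, (M j : ℝ) * Real.log (M j) - n * Real.log n + n * Real.log k := by
  have hn0 : (0 : ℝ) < n := by exact_mod_cast hn
  have hk0 : (0 : ℝ) < k := by positivity
  have hM' : ∑ j, (M j : ℝ) = n := by exact_mod_cast hM
  have h := entropy_deficit_ge hk (fun j => (M j : ℝ) / n) (fun j => by positivity)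
    (by rw [← sum_div, hM', div_self hn0.ne'])
  have h1 : ∀ j, (M j : ℝ) / n * Real.log (M j / n) =
      ((M j : ℝ) * Real.log (M j) - M j * Real.log n) / n := by
    intro j
    rcases Nat.eq_zero_or_pos (M j) with h0 | h0
    · simp [h0]
    · rw [Real.log_div (by positivity) hn0.ne']; ring
  have h2 : ∑ j, ((M j : ℝ) - n / k) ^ 2 / n = n * (∑ j, ((M j : ℝ) / n) ^ 2 - 1 / k) := by
    have : ∀ j, ((M j : ℝ) - n / k) ^ 2 / n =
        n * ((M j : ℝ) / n) ^ 2 - 2 / k * M j + n / k ^ 2 := fun j => by field_simp; ring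
    simp_rw [this]
    rw [sum_add_distrib, sum_sub_distrib, ← mul_sum, ← mul_sum, hM']
    simp only [sum_const, card_univ, Fintype.card_fin, nsmul_eq_mul]
    field_simp
    ring
  simp_rw [h1] at h
  rw [← sum_div, sum_sub_distrib, ← sum_mul, hM'] at h
  have h3 := mul_le_mul_of_nonneg_left h hn0.le
  rw [h2]
  calc _ = (n : ℝ) * (k * Real.log (k - 1) / (k - 1) * (∑ j, ((M j : ℝ) / n) ^ 2 - 1 / k)) := by
        ring
    _ ≤ _ := h3
    _ = _ := by field_simp

lemma exists_log_overlap_bound {k : ℕ} (hk : 3 ≤ k) {lam : ℝ}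
    (hlam : lam < (k : ℝ) * Real.log (k - 1) / (k - 1)) :
    ∃ C δ : ℝ, 0 < δ ∧ ∀ (n : ℕ) (M : Fin k → Fin k → ℕ), 1 ≤ n → (∀ i, ∑ j, M i j = n) →
      2 * k * Real.log n.factorial - Real.log (k * n).factorial
        - ∑ i, ∑ j, Real.log (M i j).factorial
        + lam * ∑ i, ∑ j, ((M i j : ℝ) - n / k) ^ 2 / n ≤
      C - (k - 1) ^ 2 / 2 * Real.log n - δ * ∑ i, ∑ j, ((M i j : ℝ) - n / k) ^ 2 / n := by
  set K := (k : ℝ) * Real.log (k - 1) / (k - 1) with hK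
  obtain ⟨C, hC⟩ := exists_log_max_bound (k := k) (by omega)
    (ε := (K - lam) / 2) (by linarith)
  refine ⟨2 * k + k ^ 2 * C, (K - lam) / 2, by linarith, fun n M hn hM => ?_⟩
  have hn0 : (0 : ℝ) < n := by exact_mod_cast hn
  have hk0 : (0 : ℝ) < k := by positivity
  set Φ := ∑ i, ∑ j, ((M i j : ℝ) - n / k) ^ 2 / n with hΦ
  have hM' : ∀ i, ∑ j, (M i j : ℝ) = n := fun i => by exact_mod_cast hM i
  have h1 := mul_le_mul_of_nonneg_left (log_factorial_le hn) (by positivity : (0 : ℝ) ≤ 2 * k)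
  have h2 := le_log_factorial (k * n)
  have h2' : Real.log n ≤ Real.log (max 1 ((k * n : ℕ) : ℝ)) := by
    refine Real.log_le_log hn0 (le_trans ?_ (le_max_right _ _))
    exact_mod_cast Nat.le_mul_of_pos_left n (by omega)
  push_cast at h2 h2'
  rw [Real.log_mul hk0.ne' hn0.ne'] at h2
  have h3 : ∑ i, ∑ j, (Real.log (max 1 (M i j)) / 2 + M i j * Real.log (M i j) - M i j) ≤
      ∑ i, ∑ j, Real.log (M i j).factorial :=
    sum_le_sum fun i _ => sum_le_sum fun j _ => le_log_factorial _
  have h4 : ∑ i : Fin k, ∑ j : Fin k, Real.log n / 2 ≤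
      ∑ i, ∑ j, (Real.log (max 1 (M i j)) / 2 + C +
        (K - lam) / 2 * (((M i j : ℝ) - n / k) ^ 2 / n)) :=
    sum_le_sum fun i _ => sum_le_sum fun j _ => hC n (M i j) hn
  have h5 : ∑ i, K * ∑ j, ((M i j : ℝ) - n / k) ^ 2 / n ≤
      ∑ i, (∑ j, (M i j : ℝ) * Real.log (M i j) - n * Real.log n + n * Real.log k) :=
    sum_le_sum fun i _ => row_entropy_ge hk hn (M i) (hM i)
  simp only [sum_add_distrib, sum_sub_distrib, ← mul_sum, hM', sum_const, card_univ,
    Fintype.card_fin, nsmul_eq_mul] at h3 h4 h5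
  rw [← hΦ] at h4 h5
  linarith

lemma card_fibers_mul_prod_factorial {N : ℕ} {ι : Type*} [Fintype ι] [DecidableEq ι] (M : ι → ℕ)
    (hM : ∑ i, M i = N) :
    #{f : Fin N → ι | ∀ i, #{v | f v = i} = M i} * ∏ i, (M i).factorial = N.factorial := by
  set d : ι →₀ ℕ := Finsupp.equivFunOnFinite.symm M with hd
  have hsum : d.sum (fun _ m => m) = N := by
    rw [Finsupp.sum_fintype _ _ (by simp)]
    simpa [hd] using hM
  have h := MvPolynomial.coeff_sum_X_pow_of_fintype (R := ℕ) d N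
  rw [if_pos hsum, Fintype.sum_pow, MvPolynomial.coeff_sum] at h
  have hc : ∀ f : Fin N → ι, MvPolynomial.coeff d (∏ v, (MvPolynomial.X (f v) :
      MvPolynomial ι ℕ)) = if ∀ i, #{v | f v = i} = M i then 1 else 0 := by
    intro f
    have : ∏ v, (MvPolynomial.X (f v) : MvPolynomial ι ℕ) =
        MvPolynomial.monomial (∑ v, Finsupp.single (f v) 1) 1 := by
      rw [MvPolynomial.monomial_sum_one]
      rfl
    rw [this, MvPolynomial.coeff_monomial]
    refine if_congr ?_ rfl rfl
    rw [DFunLike.ext_iff]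
    simp [hd, Finsupp.finsetSum_apply, Finsupp.single_apply]
  simp_rw [hc] at h
  rw [← card_filter] at h
  rw [h, Finsupp.multinomial]
  have e1 : ∏ i, (M i).factorial = d.prod fun _ n => n.factorial := by
    rw [Finsupp.prod_fintype _ _ (by simp)]
    simp [hd]
  have e2 : (d.sum fun _ => id) = N := hsum
  rw [e1, e2, Nat.cast_id]
  refine Nat.div_mul_cancel ?_
  rw [← e1, ← hM]
  exact Nat.prod_factorial_dvd_factorial_sum _ _

/-- The colorings of `Fin N` in which every color is used exactly `n` times. -/
noncomputable def balancedColorings (k N n : ℕ) : Finset (Fin N → Fin k) :=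
  {σ | ∀ i, #{v | σ v = i} = n}

/-- The number of vertices colored `i` by `σ` and `j` by `τ`. -/
noncomputable def overlap {N k : ℕ} (σ τ : Fin N → Fin k) (i j : Fin k) : ℕ :=
  #{v | σ v = i ∧ τ v = j}

lemma mem_balancedColorings {k N n : ℕ} {σ : Fin N → Fin k} :
    σ ∈ balancedColorings k N n ↔ ∀ i, #{v | σ v = i} = n := by
  simp [balancedColorings]

lemma sum_overlap_right {N k : ℕ} (σ τ : Fin N → Fin k) (i : Fin k) :
    ∑ j, overlap σ τ i j = #{v | σ v = i} := by
  rw [card_eq_sum_card_fiberwise (f := τ) (t := univ) (fun _ _ => mem_univ _)]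
  simp [overlap, filter_filter]

lemma sum_overlap_left {N k : ℕ} (σ τ : Fin N → Fin k) (j : Fin k) :
    ∑ i, overlap σ τ i j = #{v | τ v = j} := by
  rw [card_eq_sum_card_fiberwise (f := σ) (t := univ) (fun _ _ => mem_univ _)]
  simp [overlap, filter_filter, and_comm]

lemma card_pairs_eq {N : ℕ} {ι : Type*} [Fintype ι] [DecidableEq ι] (f : Fin N → ι) :
    #{p : Fin N × Fin N | f p.1 = f p.2} = ∑ i, #{v | f v = i} ^ 2 := by
  rw [card_eq_sum_card_fiberwise (f := fun p => f p.1) (t := univ) (fun _ _ => mem_univ _)]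
  refine sum_congr rfl fun i _ => ?_
  rw [sq, ← card_product]
  congr 1
  ext p
  simp only [mem_filter, mem_univ, true_and, mem_product]
  grind

lemma card_monochromatic {k n : ℕ} {σ : Fin (k * n) → Fin k}
    (hσ : σ ∈ balancedColorings k (k * n) n) :
    #{p : Fin (k * n) × Fin (k * n) | σ p.1 = σ p.2} = k * n ^ 2 := by
  rw [card_pairs_eq]
  simp [mem_balancedColorings.1 hσ]

lemma card_bichromatic {k n : ℕ} {σ : Fin (k * n) → Fin k}
    (hσ : σ ∈ balancedColorings k (k * n) n) :
    (#{p : Fin (k * n) × Fin (k * n) | σ p.1 ≠ σ p.2} : ℝ) = (k * n) ^ 2 - k * n ^ 2 := by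
  have h1 := card_filter_add_card_filter_not (s := (univ : Finset (Fin (k * n) × Fin (k * n))))
    (fun p => σ p.1 = σ p.2)
  rw [card_monochromatic hσ] at h1
  simp only [card_univ, Fintype.card_fin, Fintype.card_prod] at h1
  have h2 : (k * n ^ 2 + #{p : Fin (k * n) × Fin (k * n) | ¬ σ p.1 = σ p.2} : ℝ)
    = k * n * (k * n) := by exact_mod_cast h1
  linarith

lemma card_bichromatic_both {k n : ℕ} {σ τ : Fin (k * n) → Fin k}
    (hσ : σ ∈ balancedColorings k (k * n) n) (hτ : τ ∈ balancedColorings k (k * n) n) :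
    (#{p : Fin (k * n) × Fin (k * n) | σ p.1 ≠ σ p.2 ∧ τ p.1 ≠ τ p.2} : ℝ) =
      (k * n) ^ 2 - 2 * k * n ^ 2 + ∑ i, ∑ j, (overlap σ τ i j : ℝ) ^ 2 := by
  have h1 := card_bichromatic hσ
  have h2 := card_filter_add_card_filter_not
    (s := ({p | σ p.1 ≠ σ p.2} : Finset (Fin (k * n) × Fin (k * n))))
    (fun p => τ p.1 = τ p.2)
  have h3 := card_filter_add_card_filter_not
    (s := ({p | τ p.1 = τ p.2} : Finset (Fin (k * n) × Fin (k * n))))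
    (fun p => σ p.1 = σ p.2)
  have h4 := card_monochromatic hτ
  have h5 := card_pairs_eq (fun v => (σ v, τ v))
  simp only [Prod.mk.injEq, Fintype.sum_prod_type] at h5
  rw [filter_filter, filter_filter] at h2 h3
  have e1 : ({p | τ p.1 = τ p.2 ∧ σ p.1 = σ p.2} : Finset (Fin (k * n) × Fin (k * n))) =
      ({p | σ p.1 = σ p.2 ∧ τ p.1 = τ p.2} : Finset (Fin (k * n) × Fin (k * n))) :=
    filter_congr fun _ _ => and_comm
  have e2 : ({p | τ p.1 = τ p.2 ∧ ¬ σ p.1 = σ p.2} : Finset (Fin (k * n) × Fin (k * n))) =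
      ({p | σ p.1 ≠ σ p.2 ∧ τ p.1 = τ p.2} : Finset (Fin (k * n) × Fin (k * n))) :=
    filter_congr fun _ _ => and_comm
  rw [e1, e2, h4, h5] at h3
  have h2' : (_ : ℝ) = _ := congrArg (Nat.cast : ℕ → ℝ) h2
  have h3' : (_ : ℝ) = _ := congrArg (Nat.cast : ℕ → ℝ) h3
  push_cast at h2' h3'
  simp only [overlap]
  linarith

lemma card_edges_pow {N m : ℕ} (P : Fin N × Fin N → Prop) :
    #{e : Fin m → Fin N × Fin N | ∀ i, P (e i)} = #{p | P p} ^ m := by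
  have : ({e : Fin m → Fin N × Fin N | ∀ i, P (e i)} : Finset _) =
      Fintype.piFinset fun _ => ({p | P p} : Finset (Fin N × Fin N)) := by
    ext e; simp
  rw [this, Fintype.card_piFinset_const]

lemma sq_sum_card_le {Ω ι : Type*} [Fintype Ω] (S : Finset ι) (R : Ω → ι → Prop) :
    (∑ σ ∈ S, (#{e | R e σ} : ℝ)) ^ 2 ≤
      #{e | ∃ σ, R e σ} * ∑ σ ∈ S, ∑ τ ∈ S, (#{e | R e σ ∧ R e τ} : ℝ) := by
  let Y : Ω → ℝ := fun e => ∑ σ ∈ S, if R e σ then 1 else 0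
  have h1 : ∑ σ ∈ S, (#{e | R e σ} : ℝ) = ∑ e, (if ∃ σ, R e σ then 1 else 0) * Y e := by
    have : ∀ e, (if ∃ σ, R e σ then (1 : ℝ) else 0) * Y e = Y e := by
      intro e
      split_ifs with h
      · rw [one_mul]
      · push Not at h
        simp [Y, h]
    simp_rw [this, Y]
    rw [sum_comm]
    simp
  have h2 : ∑ σ ∈ S, ∑ τ ∈ S, (#{e | R e σ ∧ R e τ} : ℝ) = ∑ e, Y e ^ 2 := by
    have : ∀ e, Y e ^ 2 = ∑ σ ∈ S, ∑ τ ∈ S, if R e σ ∧ R e τ then (1 : ℝ) else 0 := by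
      intro e
      rw [sq, sum_mul_sum]
      refine sum_congr rfl fun σ _ => sum_congr rfl fun τ _ => ?_
      split_ifs <;> simp_all
    simp_rw [this]
    symm
    rw [sum_comm]
    refine sum_congr rfl fun σ _ => ?_
    rw [sum_comm]
    simp
  have h3 : ∑ e, (if ∃ σ, R e σ then (1 : ℝ) else 0) ^ 2 = #{e | ∃ σ, R e σ} := by
    simp
  rw [h1, h2, ← h3]
  exact sum_mul_sq_le_sq_mul_sq _ _ _

lemma card_balancedColorings_mul (k n : ℕ) :
    #(balancedColorings k (k * n) n) * n.factorial ^ k = (k * n).factorial := by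
  have h := card_fibers_mul_prod_factorial (N := k * n) (fun _ : Fin k => n) (by simp)
  rw [prod_const, card_univ, Fintype.card_fin] at h
  convert h using 3
  ext f
  simp [balancedColorings]

/-- The matrices that can occur as overlap matrices of two balanced colorings. -/
noncomputable def overlapMatrices (k n : ℕ) : Finset (Fin k → Fin k → ℕ) :=
  {M ∈ Fintype.piFinset fun _ => Fintype.piFinset fun _ => range (n + 1) |
    (∀ i, ∑ j, M i j = n) ∧ ∀ j, ∑ i, M i j = n}

lemma overlap_mem {k N n : ℕ} {σ τ : Fin N → Fin k} (hσ : σ ∈ balancedColorings k N n)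
    (hτ : τ ∈ balancedColorings k N n) : overlap σ τ ∈ overlapMatrices k n := by
  have h1 : ∀ i, ∑ j, overlap σ τ i j = n := fun i => by
    rw [sum_overlap_right, mem_balancedColorings.1 hσ]
  have h2 : ∀ j, ∑ i, overlap σ τ i j = n := fun j => by
    rw [sum_overlap_left, mem_balancedColorings.1 hτ]
  simp only [overlapMatrices, mem_filter, Fintype.mem_piFinset, mem_range]
  refine ⟨fun i j => Nat.lt_succ_of_le ?_, h1, h2⟩
  exact (single_le_sum (fun _ _ => Nat.zero_le _) (mem_univ j)).trans_eq (h1 i)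

lemma card_overlap_eq_mul_le {k n : ℕ} (M : Fin k → Fin k → ℕ) (hM : ∀ i, ∑ j, M i j = n)
    (S : Finset ((Fin (k * n) → Fin k) × (Fin (k * n) → Fin k))) :
    #{p ∈ S | overlap p.1 p.2 = M} * ∏ i, ∏ j, (M i j).factorial ≤ (k * n).factorial := by
  have h := card_fibers_mul_prod_factorial (N := k * n) (fun q : Fin k × Fin k => M q.1 q.2)
    (by rw [Fintype.sum_prod_type]; simp [hM])
  rw [Fintype.prod_prod_type] at h
  rw [← h]
  gcongr
  refine card_le_card_of_injOn (fun p v => (p.1 v, p.2 v)) (fun p hp => ?_) ?_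
  · have hp : overlap p.1 p.2 = M := (mem_filter.1 hp).2
    simp only [coe_filter, mem_univ, true_and, Set.mem_ofPred_eq, Prod.forall, Prod.mk.injEq]
    intro i j
    rw [← hp]
    rfl
  · intro p _ p' _ h
    have h' := fun v => Prod.mk.inj (congrFun h v)
    exact Prod.ext (funext fun v => (h' v).1) (funext fun v => (h' v).2)

lemma overlapMatrices_injOn (l n : ℕ) :
    Set.InjOn (fun (M : Fin (l + 1) → Fin (l + 1) → ℕ) (q : Fin l × Fin l) =>
      M q.1.castSucc q.2.castSucc) (overlapMatrices (l + 1) n) := by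
  intro M hM M' hM' h
  obtain ⟨hr, hc⟩ := (mem_filter.1 hM).2
  obtain ⟨hr', hc'⟩ := (mem_filter.1 hM').2
  have h1 : ∀ i j : Fin l, M i.castSucc j.castSucc = M' i.castSucc j.castSucc :=
    fun i j => congrFun h (i, j)
  have h2 : ∀ (i : Fin l) j, M i.castSucc j = M' i.castSucc j := by
    intro i j
    refine Fin.lastCases ?_ (h1 i) j
    have := (hr i.castSucc).trans (hr' i.castSucc).symm
    rw [Fin.sum_univ_castSucc, Fin.sum_univ_castSucc, sum_congr rfl fun j _ => h1 i j] at this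
    exact Nat.add_left_cancel this
  ext i j
  refine Fin.lastCases ?_ (fun i => h2 i j) i
  have := (hc j).trans (hc' j).symm
  rw [Fin.sum_univ_castSucc, Fin.sum_univ_castSucc, sum_congr rfl fun i _ => h2 i j] at this
  exact Nat.add_left_cancel this

lemma sum_overlapMatrices_prod_le (l n : ℕ) (ψ : ℕ → ℝ) (hψ : ∀ z, 0 ≤ ψ z) :
    ∑ M ∈ overlapMatrices (l + 1) n, ∏ q : Fin l × Fin l, ψ (M q.1.castSucc q.2.castSucc) ≤
      (∑ z ∈ range (n + 1), ψ z) ^ (l * l) := by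
  have h : (∑ z ∈ range (n + 1), ψ z) ^ (l * l) =
      ∑ z ∈ Fintype.piFinset fun _ : Fin l × Fin l => range (n + 1), ∏ q, ψ (z q) := by
    rw [← prod_univ_sum]
    simp
  rw [h, ← sum_image (f := fun z : Fin l × Fin l → ℕ => ∏ q, ψ (z q)) (overlapMatrices_injOn l n)]
  refine sum_le_sum_of_subset_of_nonneg ?_ fun _ _ _ => prod_nonneg fun _ _ => hψ _
  intro z hz
  obtain ⟨M, hM, rfl⟩ := mem_image.1 hz
  have := (mem_filter.1 hM).1
  simp only [Fintype.mem_piFinset] at this ⊢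
  exact fun q => this _ _

lemma exists_sum_exp_overlap_le {l : ℕ} (hl : 2 ≤ l) {lam : ℝ}
    (hlam : lam < ((l + 1 : ℕ) : ℝ) * Real.log ((l + 1 : ℕ) - 1) / ((l + 1 : ℕ) - 1)) :
    ∃ C : ℝ, 0 < C ∧ ∀ n : ℕ, 1 ≤ n →
      ∑ σ ∈ balancedColorings (l + 1) ((l + 1) * n) n,
        ∑ τ ∈ balancedColorings (l + 1) ((l + 1) * n) n,
          Real.exp (lam * ∑ i, ∑ j, ((overlap σ τ i j : ℝ) - n / (l + 1 : ℕ)) ^ 2 / n) ≤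
        C * (#(balancedColorings (l + 1) ((l + 1) * n) n) : ℝ) ^ 2 := by
  obtain ⟨C, δ, hδ, hC⟩ := exists_log_overlap_bound (by omega) hlam
  set k := l + 1 with hk
  set G := Real.exp δ * (1 + Real.exp (2 * δ)) * (1 + 1 / (2 * δ)) with hG
  refine ⟨Real.exp C * G ^ (l * l), by positivity, fun n hn => ?_⟩
  have hn0 : (0 : ℝ) < n := by exact_mod_cast hn
  set S := balancedColorings k (k * n) n
  set w : (Fin k → Fin k → ℕ) → ℝ := fun M =>
    Real.exp (lam * ∑ i, ∑ j, ((M i j : ℝ) - n / k) ^ 2 / n) with hw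
  set ψ : ℕ → ℝ := fun z => Real.exp (-(Real.log n / 2) + -δ * ((z - n / k : ℝ) ^ 2 / n)) with hψ
  have hSf : (#S : ℝ) * (n.factorial : ℝ) ^ k = (k * n).factorial := by
    exact_mod_cast card_balancedColorings_mul k n
  have hS0 : (0 : ℝ) < #S := by
    have : (0 : ℝ) < (k * n).factorial := by positivity
    rw [← hSf] at this
    exact pos_of_mul_pos_left this (by positivity)
  have hSlog : Real.log #S = Real.log (k * n).factorial - k * Real.log n.factorial := by
    rw [← hSf, Real.log_mul hS0.ne' (by positivity), Real.log_pow]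
    ring
  have hψsum : ∑ z ∈ range (n + 1), ψ z ≤ G := by
    simp_rw [hψ, Real.exp_add]
    rw [← mul_sum]
    have h1 : Real.exp (-(Real.log n / 2)) * √(n : ℝ) = 1 := by
      rw [← Real.exp_log (Real.sqrt_pos.2 hn0), Real.log_sqrt hn0.le, ← Real.exp_add]
      simp
    calc _ ≤ Real.exp (-(Real.log n / 2)) * (G * √(n : ℝ)) := by
          gcongr
          exact sum_gaussian_le hδ (by positivity) hn (n + 1)
      _ = G * (Real.exp (-(Real.log n / 2)) * √(n : ℝ)) := by ring
      _ = G := by rw [h1, mul_one]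
  have hterm : ∀ M ∈ overlapMatrices k n,
      (#{p ∈ S ×ˢ S | overlap p.1 p.2 = M} : ℝ) * w M ≤
        Real.exp C * (#S : ℝ) ^ 2 * ∏ q : Fin l × Fin l, ψ (M q.1.castSucc q.2.castSucc) := by
    intro M hM
    obtain ⟨hr, -⟩ := (mem_filter.1 hM).2
    set F : ℝ := ∏ i, ∏ j, ((M i j).factorial : ℝ) with hF
    have hF0 : 0 < F := prod_pos fun i _ => prod_pos fun j _ => by positivity
    have hFlog : Real.log F = ∑ i, ∑ j, Real.log (M i j).factorial := by
      rw [hF, Real.log_prod fun i _ => (prod_pos fun j _ => by positivity).ne']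
      exact sum_congr rfl fun i _ => Real.log_prod fun j _ => by positivity
    have hcard : (#{p ∈ S ×ˢ S | overlap p.1 p.2 = M} : ℝ) ≤ (k * n).factorial / F := by
      rw [le_div_iff₀ hF0, hF]
      exact_mod_cast card_overlap_eq_mul_le M hr (S ×ˢ S)
    have hprod : ∏ q : Fin l × Fin l, ψ (M q.1.castSucc q.2.castSucc) =
        Real.exp (-((l : ℝ) ^ 2 / 2 * Real.log n) +
          -δ * ∑ i : Fin l, ∑ j : Fin l,
            ((M i.castSucc j.castSucc : ℝ) - n / k) ^ 2 / n) := by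
      simp_rw [hψ]
      rw [← Real.exp_sum, sum_add_distrib, ← mul_sum, sum_const, Fintype.sum_prod_type]
      congr 2
      simp only [card_univ, Fintype.card_fin, Fintype.card_prod, nsmul_eq_mul]
      push_cast
      ring
    have hminor : ∑ i : Fin l, ∑ j : Fin l, ((M i.castSucc j.castSucc : ℝ) - n / k) ^ 2 / n ≤
        ∑ i, ∑ j, ((M i j : ℝ) - n / k) ^ 2 / n := by
      rw [Fin.sum_univ_castSucc (n := l)]
      refine le_add_of_le_of_nonneg (sum_le_sum fun i _ => ?_)
        (sum_nonneg fun j _ => by positivity)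
      rw [Fin.sum_univ_castSucc (n := l)]
      exact le_add_of_nonneg_right (by positivity)
    have hlog := hC n M hn hr
    rw [show ((k : ℕ) : ℝ) - 1 = l by rw [hk]; push_cast; ring] at hlog
    have hminor' := mul_le_mul_of_nonneg_left hminor hδ.le
    calc (#{p ∈ S ×ˢ S | overlap p.1 p.2 = M} : ℝ) * w M
        ≤ (k * n).factorial / F * w M := by gcongr
      _ = Real.exp (Real.log (k * n).factorial - Real.log F +
            lam * ∑ i, ∑ j, ((M i j : ℝ) - n / k) ^ 2 / n) := by
          rw [Real.exp_add, Real.exp_sub, Real.exp_log (by positivity), Real.exp_log hF0]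
      _ ≤ Real.exp (C + (Real.log #S + Real.log #S) + (-((l : ℝ) ^ 2 / 2 * Real.log n) +
          -δ * ∑ i : Fin l, ∑ j : Fin l,
            ((M i.castSucc j.castSucc : ℝ) - n / k) ^ 2 / n)) := by
          rw [Real.exp_le_exp, hFlog, hSlog]
          linarith
      _ = _ := by
          rw [hprod, Real.exp_add, Real.exp_add C, Real.exp_add (Real.log _),
            Real.exp_log hS0]
          ring
  calc ∑ σ ∈ S, ∑ τ ∈ S, w (overlap σ τ)
      = ∑ p ∈ S ×ˢ S, w (overlap p.1 p.2) := by rw [sum_product]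
    _ = ∑ M ∈ overlapMatrices k n, ∑ p ∈ S ×ˢ S with overlap p.1 p.2 = M,
          w (overlap p.1 p.2) := by
        refine (sum_fiberwise_of_maps_to (fun p hp => ?_) _).symm
        exact overlap_mem (mem_product.1 hp).1 (mem_product.1 hp).2
    _ = ∑ M ∈ overlapMatrices k n, (#{p ∈ S ×ˢ S | overlap p.1 p.2 = M} : ℝ) * w M := by
        refine sum_congr rfl fun M _ => ?_
        rw [sum_congr rfl fun p hp => by rw [(mem_filter.1 hp).2], sum_const, nsmul_eq_mul]
    _ ≤ ∑ M ∈ overlapMatrices k n, Real.exp C * (#S : ℝ) ^ 2 *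
          ∏ q : Fin l × Fin l, ψ (M q.1.castSucc q.2.castSucc) := sum_le_sum hterm
    _ ≤ Real.exp C * (#S : ℝ) ^ 2 * G ^ (l * l) := by
        rw [← mul_sum]
        gcongr
        refine (sum_overlapMatrices_prod_le l n ψ fun z => (Real.exp_pos _).le).trans ?_
        gcongr
    _ = _ := by ring

lemma card_isProperColoring {k n m : ℕ} {σ : Fin (k * n) → Fin k}
    (hσ : σ ∈ balancedColorings k (k * n) n) :
    (#{e : Fin m → Fin (k * n) × Fin (k * n) | IsProperColoring e σ} : ℝ) =
      ((k * n) ^ 2 - k * n ^ 2) ^ m := by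
  have h := card_edges_pow (m := m) (fun p : Fin (k * n) × Fin (k * n) => σ p.1 ≠ σ p.2)
  rw [← card_bichromatic hσ, ← Nat.cast_pow, Nat.cast_inj]
  convert h
  rfl

lemma card_isProperColoring_both {k n m : ℕ} {σ τ : Fin (k * n) → Fin k}
    (hσ : σ ∈ balancedColorings k (k * n) n) (hτ : τ ∈ balancedColorings k (k * n) n) :
    (#{e : Fin m → Fin (k * n) × Fin (k * n) | IsProperColoring e σ ∧ IsProperColoring e τ} : ℝ) =
      ((k * n) ^ 2 - 2 * k * n ^ 2 + ∑ i, ∑ j, (overlap σ τ i j : ℝ) ^ 2) ^ m := by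
  have h := card_edges_pow (m := m)
    (fun p : Fin (k * n) × Fin (k * n) => σ p.1 ≠ σ p.2 ∧ τ p.1 ≠ τ p.2)
  rw [← card_bichromatic_both hσ hτ, ← Nat.cast_pow, Nat.cast_inj]
  convert h
  simp [IsProperColoring, forall_and]

lemma sum_sq_overlap {k n : ℕ} (hk : 1 ≤ k) {σ τ : Fin (k * n) → Fin k}
    (hσ : σ ∈ balancedColorings k (k * n) n) :
    ∑ i, ∑ j, (overlap σ τ i j : ℝ) ^ 2 =
      ∑ i, ∑ j, ((overlap σ τ i j : ℝ) - n / k) ^ 2 + n ^ 2 := by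
  have hk0 : (k : ℝ) ≠ 0 := by positivity
  have hrow : ∀ i, ∑ j, (overlap σ τ i j : ℝ) = n := fun i => by
    exact_mod_cast (sum_overlap_right σ τ i).trans (mem_balancedColorings.1 hσ i)
  have h : ∀ i, ∑ j, ((overlap σ τ i j : ℝ) - n / k) ^ 2 =
      ∑ j, (overlap σ τ i j : ℝ) ^ 2 - n ^ 2 / k := fun i => by
    simp_rw [sub_sq]
    rw [sum_add_distrib, sum_sub_distrib, ← sum_mul, ← mul_sum, hrow]
    simp
    field_simp
    ring
  simp_rw [h]
  rw [sum_sub_distrib]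
  simp
  field_simp
  ring

lemma card_isProperColoring_both_le {k n m : ℕ} (hk : 2 ≤ k) (hn : 1 ≤ n) {c : ℝ}
    (hm : m ≤ c * (k * n))
    {σ τ : Fin (k * n) → Fin k}
    (hσ : σ ∈ balancedColorings k (k * n) n) (hτ : τ ∈ balancedColorings k (k * n) n) :
    (#{e : Fin m → Fin (k * n) × Fin (k * n) | IsProperColoring e σ ∧ IsProperColoring e τ} : ℝ) ≤
      ((n * (k - 1)) ^ 2) ^ m * Real.exp (c * k / (k - 1) ^ 2 *
        ∑ i, ∑ j, ((overlap σ τ i j : ℝ) - n / k) ^ 2 / n) := by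
  have hn0 : (0 : ℝ) < n := by exact_mod_cast hn
  have hk1 : (0 : ℝ) < (k : ℝ) - 1 := by
    have : (2 : ℝ) ≤ k := by exact_mod_cast hk
    linarith
  have hΦ : ∑ i, ∑ j, ((overlap σ τ i j : ℝ) - n / k) ^ 2 / n =
      (∑ i, ∑ j, ((overlap σ τ i j : ℝ) - n / k) ^ 2) / n := by
    simp_rw [sum_div]
  rw [card_isProperColoring_both hσ hτ, sum_sq_overlap (by omega) hσ, hΦ]
  set D := ∑ i, ∑ j, ((overlap σ τ i j : ℝ) - n / k) ^ 2
  have hD : 0 ≤ D := sum_nonneg fun i _ => sum_nonneg fun j _ => sq_nonneg _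
  have hg : ((k * n : ℝ) ^ 2 - 2 * k * n ^ 2 + (D + n ^ 2)) =
      (n * (k - 1)) ^ 2 * (D / (n * (k - 1)) ^ 2 + 1) := by
    field_simp
    ring
  rw [hg, mul_pow]
  gcongr
  calc (D / (n * ((k : ℝ) - 1)) ^ 2 + 1) ^ m
      ≤ Real.exp (D / (n * ((k : ℝ) - 1)) ^ 2) ^ m := by
        gcongr
        exact Real.add_one_le_exp _
    _ = Real.exp (m * (D / (n * ((k : ℝ) - 1)) ^ 2)) := by rw [← Real.exp_nat_mul]
    _ ≤ Real.exp (c * (k * n) * (D / (n * ((k : ℝ) - 1)) ^ 2)) := by gcongr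
    _ = _ := by
        congr 1
        field_simp

lemma multigraphProb_le_one (n m : ℕ) (P : (Fin m → Fin n × Fin n) → Prop) :
    multigraphProb n m P ≤ 1 := by
  refine div_le_one_of_le₀ ?_ (by positivity)
  have h := card_le_univ (univ.filter P)
  simp only [Fintype.card_fun, Fintype.card_prod, Fintype.card_fin] at h
  rw [sq]
  exact_mod_cast h

lemma inv_le_multigraphProb {k n m : ℕ} (hk : 2 ≤ k) (hn : 1 ≤ n) {c C : ℝ} (hC : 0 < C)
    (hm : m ≤ c * (k * n))
    (h : ∑ σ ∈ balancedColorings k (k * n) n, ∑ τ ∈ balancedColorings k (k * n) n,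
        Real.exp (c * k / (k - 1) ^ 2 *
          ∑ i, ∑ j, ((overlap σ τ i j : ℝ) - n / k) ^ 2 / n) ≤
      C * (#(balancedColorings k (k * n) n) : ℝ) ^ 2) :
    C⁻¹ ≤ multigraphProb (k * n) m (fun e => ∃ σ : Fin (k * n) → Fin k, IsProperColoring e σ) := by
  have hn0 : (0 : ℝ) < n := by exact_mod_cast hn
  have hk1 : (0 : ℝ) < (k : ℝ) - 1 := by
    have : (2 : ℝ) ≤ k := by exact_mod_cast hk
    linarith
  have hk0 : (0 : ℝ) < k := by linarith
  have hS : (0 : ℝ) < #(balancedColorings k (k * n) n) := by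
    have := (k * n).factorial_pos
    rw [← card_balancedColorings_mul] at this
    exact_mod_cast Nat.pos_of_mul_pos_right this
  set S := balancedColorings k (k * n) n
  set A : ℝ := (#{e : Fin m → Fin (k * n) × Fin (k * n) |
    ∃ σ : Fin (k * n) → Fin k, IsProperColoring e σ} : ℝ) with hA
  set Q : ℝ := (n * ((k : ℝ) - 1)) ^ 2 with hQ
  have hQ0 : 0 < Q := by positivity
  have hfirst : ∑ σ ∈ S, (#{e : Fin m → Fin (k * n) × Fin (k * n) | IsProperColoring e σ} : ℝ) =
      #S * ((k * n : ℝ) ^ 2 - k * n ^ 2) ^ m := by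
    rw [sum_congr rfl fun σ hσ => card_isProperColoring hσ, sum_const, nsmul_eq_mul]
  have hsecond : ∑ σ ∈ S, ∑ τ ∈ S, (#{e : Fin m → Fin (k * n) × Fin (k * n) |
      IsProperColoring e σ ∧ IsProperColoring e τ} : ℝ) ≤ Q ^ m * (C * (#S : ℝ) ^ 2) := by
    refine le_trans ?_ (mul_le_mul_of_nonneg_left h (by positivity))
    simp_rw [mul_sum]
    refine sum_le_sum fun σ hσ => sum_le_sum fun τ hτ => ?_
    simpa only [mul_sum] using card_isProperColoring_both_le hk hn hm hσ hτ
  have hcs := sq_sum_card_le S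
    (fun (e : Fin m → Fin (k * n) × Fin (k * n)) (σ : Fin (k * n) → Fin k) => IsProperColoring e σ)
  have hA0 : 0 ≤ A := by positivity
  replace hcs : (∑ σ ∈ S, (#{e : Fin m → Fin (k * n) × Fin (k * n) | IsProperColoring e σ} : ℝ)) ^ 2
      ≤ A * ∑ σ ∈ S, ∑ τ ∈ S, (#{e : Fin m → Fin (k * n) × Fin (k * n) |
        IsProperColoring e σ ∧ IsProperColoring e τ} : ℝ) := by
    convert hcs
  rw [hfirst] at hcs
  have hmain := hcs.trans (mul_le_mul_of_nonneg_left hsecond hA0)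
  have hsq : (#S * ((k * n : ℝ) ^ 2 - k * n ^ 2) ^ m) ^ 2 =
      (Q ^ m * (#S : ℝ) ^ 2) * ((k * n : ℝ) ^ 2) ^ m := by
    have : ((k * n : ℝ) ^ 2 - k * n ^ 2) ^ 2 = Q * (k * n : ℝ) ^ 2 := by
      rw [hQ]; ring
    rw [mul_pow, ← pow_mul, mul_comm m, pow_mul, this, mul_pow]
    ring
  rw [hsq] at hmain
  have hP : ((k * n : ℝ) ^ 2) ^ m ≤ A * C := by
    refine le_of_mul_le_mul_left (hmain.trans_eq ?_) (by positivity : 0 < Q ^ m * (#S : ℝ) ^ 2)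
    ring
  have hprob : multigraphProb (k * n) m
      (fun e => ∃ σ : Fin (k * n) → Fin k, IsProperColoring e σ) = A / ((k * n : ℝ) ^ 2) ^ m := by
    rw [multigraphProb, Nat.cast_mul, hA]
    congr
  rw [hprob, le_div_iff₀ (by positivity), inv_mul_le_iff₀ hC]
  linarith

/-- If `0 < c < (k-1) log (k-1)`, then the random multigraph `G(kn, ⌊c k n⌋)` is
`k`-colorable with uniformly positive probability. -/
theorem multigraph_k_colorable_wupp (k : ℕ) (hk : 2 ≤ k) (c : ℝ) (hc₀ : 0 < c)
    (hc : c < (k - 1) * Real.log (k - 1)) :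
    0 < liminf (fun n : ℕ =>
        multigraphProb (k * n) ⌊c * (k * n)⌋₊
          (fun e => ∃ σ : Fin (k * n) → Fin k, IsProperColoring e σ))
      atTop := by
  obtain ⟨l, rfl⟩ : ∃ l, k = l + 1 := ⟨k - 1, by omega⟩
  have hl : 2 ≤ l := by
    by_contra! hl
    obtain rfl : l = 1 := by omega
    norm_num at hc
    linarith
  have hl0 : (0 : ℝ) < l := by positivity
  have hl1 : ((l + 1 : ℕ) : ℝ) - 1 = l := by push_cast; ring
  have hlam : c * (l + 1 : ℕ) / (((l + 1 : ℕ) : ℝ) - 1) ^ 2 <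
      ((l + 1 : ℕ) : ℝ) * Real.log ((l + 1 : ℕ) - 1) / ((l + 1 : ℕ) - 1) := by
    rw [hl1] at hc ⊢
    rw [div_lt_div_iff₀ (by positivity) hl0]
    have := mul_lt_mul_of_pos_left hc (by positivity : 0 < ((l + 1 : ℕ) : ℝ) * l)
    linarith
  obtain ⟨C, hC, h⟩ := exists_sum_exp_overlap_le hl hlam
  refine lt_of_lt_of_le (inv_pos.2 hC) (le_liminf_of_le ?_ ?_)
  · exact (isBoundedUnder_of ⟨1, fun n => multigraphProb_le_one _ _ _⟩).isCoboundedUnder_ge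
  · filter_upwards [eventually_ge_atTop 1] with n hn
    exact inv_le_multigraphProb hk hn hC (Nat.floor_le (by positivity)) (h n hn)
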